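/- Let a and b be involutive homeomorphisms of a Cantor set X such that the homeomorphism a∘b (equivalently, the ℤ-action it generates) is minimal. If f ∈ C(X,ℤ) and there exist g, h ∈ C(X,ℤ) with f = g − g∘a and f = h − h∘b, then f = 0. -/

import Mathlib

/-- A continuous function into a Hausdorff space that is invariant under a permutation is constant
on the closure of each orbit; here the orbit of `x` is dense. -/
theorem Continuous.eq_of_dense_zpow_orbit {X Y : Type*} [TopologicalSpace X] [TopologicalSpace Y]
    [T2Space Y] {f : X → Y} (hf : Continuous f) {e : Equiv.Perm X} (he : ∀ x, f (e x) = f x)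
    {x : X} (hx : Dense (Set.range fun n : ℤ => (e ^ n) x)) (y : X) : f y = f x := by
  have hpow : ∀ n : ℤ, f ((e ^ n) x) = f x := by
    intro n
    induction n with
    | zero => simp
    | succ n ih => rw [add_comm, zpow_add, zpow_one, Equiv.Perm.mul_apply, he, ih]
    | pred n ih =>
      rw [← ih, ← he ((e ^ (-(n : ℤ) - 1)) x), ← Equiv.Perm.mul_apply, ← zpow_one_add]
      congr 3
      ring
  refine congrFun (hf.ext_on hx continuous_const ?_) y
  rintro _ ⟨n, rfl⟩
  exact hpow n

/-- A coboundary of an involution is anti-invariant under it. -/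
theorem ContinuousMap.apply_involution_eq_neg {X : Type*} [TopologicalSpace X] {a : X ≃ₜ X}
    (ha : ∀ x, a (a x) = x) {f g : C(X, ℤ)} (hf : f = g - g.comp (a : C(X, X))) (x : X) :
    f (a x) = -f x := by
  simp [hf, ha]


/-- Let `a`, `b` be involutive homeomorphisms of a Cantor set `X` such that the homeomorphism
`a ∘ b` generates a minimal `ℤ`-action.  If `f ∈ C(X, ℤ)` satisfies `f = g - g ∘ a` and
`f = h - h ∘ b` for some `g, h ∈ C(X, ℤ)`, then `f = 0`. -/
theorem coboundary_for_two_involutions_eq_zero {X : Type*} [TopologicalSpace X]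
    [CompactSpace X] [TopologicalSpace.MetrizableSpace X] [TotallyDisconnectedSpace X]
    [PerfectSpace X] [Nonempty X] (a b : X ≃ₜ X)
    (ha : ∀ x, a (a x) = x) (hb : ∀ x, b (b x) = x)
    (hmin : ∀ x : X, Dense (Set.range fun n : ℤ => ((b.trans a).toEquiv ^ n) x)) :
    ∀ f g h : C(X, ℤ),
      f = g - g.comp (a : C(X, X)) → f = h - h.comp (b : C(X, X)) → f = 0 := by
  intro f g h hg hh
  have hfa := ContinuousMap.apply_involution_eq_neg ha hg
  have hfb := ContinuousMap.apply_involution_eq_neg hb hh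
  ext x
  have hconst : f (a x) = f x :=
    f.continuous.eq_of_dense_zpow_orbit (e := (b.trans a).toEquiv)
      (fun y => by simp [hfa, hfb]) (hmin x) (a x)
  rw [hfa] at hconst
  rw [ContinuousMap.zero_apply]
  omega
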